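/- arXiv:1901.01858 — 6 statements merged into one kernel-verified Lean document; each statement's English description precedes it below -/
import Mathlib

section
/- Let S be a commutative adequate partial semigroup, let A be a J_δ-set in S, let F ∈ 𝒫_f(𝒯_S), and let ⟨H_n⟩_{n=1}^∞ be a sequence in 𝒫_f(ℕ) such that max H_n < min H_{n+1} for each n. Then for every W ∈ 𝒫_f(S) there exist a ∈ σ(W) and G ∈ 𝒫_f(ℕ) such that for all f ∈ F, ∏_{k∈G} ∏_{t∈H_k} f(t) ∈ σ(W∗a) and a ∗ ∏_{k∈G} ∏_{t∈H_k} f(t) ∈ A. -/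
universe u v

/-- A partial semigroup: a partially defined operation (modelled as an
`Option`-valued operation) which is associative in the strong sense that
`(x ∗ y) ∗ z = x ∗ (y ∗ z)`, where either side is defined iff the other is. -/
structure PartialSemigroup (S : Type u) : Type u where
  op : S → S → Option S
  assoc : ∀ x y z : S,
    (op x y).bind (fun w => op w z) = (op y z).bind (fun w => op x w)

namespace PartialSemigroup

variable {S : Type u} {T : Type v}

/-- `φ(s) = {t : s ∗ t is defined}`. -/
def phi (P : PartialSemigroup S) (s : S) : Set S :=
  {t | (P.op s t).isSome}

/-- `σ(H) = ⋂_{s ∈ H} φ(s)`. -/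
def sigma (P : PartialSemigroup S) (W : Finset S) : Set S :=
  {t | ∀ s ∈ W, t ∈ P.phi s}

/-- `S` is adequate iff `σ(H) ≠ ∅` for every finite nonempty `H ⊆ S`. -/
def Adequate (P : PartialSemigroup S) : Prop :=
  ∀ W : Finset S, W.Nonempty → (P.sigma W).Nonempty

/-- Commutativity: `x ∗ y = y ∗ x` (either both undefined, or both defined and equal). -/
def Comm (P : PartialSemigroup S) : Prop :=
  ∀ x y : S, P.op x y = P.op y x

/-- The (partial) product of a list of elements, taken in order. -/
def listProd (P : PartialSemigroup S) : List S → Option S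
  | [] => none
  | [x] => some x
  | x :: y :: l => (P.listProd (y :: l)).bind (fun w => P.op x w)

/-- The (partial) product of a list of partially defined elements, taken in order. -/
def optListProd (P : PartialSemigroup S) : List (Option S) → Option S
  | [] => none
  | [x] => x
  | x :: y :: l => (P.optListProd (y :: l)).bind (fun w => x.bind (fun a => P.op a w))

/-- `∏_{n ∈ F} f n`, the product in increasing order of indices. -/
def finProd (P : PartialSemigroup S) (f : ℕ → S) (F : Finset ℕ) : Option S :=
  P.listProd ((F.sort (· ≤ ·)).map f)

/-- `FP(⟨f n⟩_{n=m}^∞)`: all finite products with indices at least `m`. -/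
def FP (P : PartialSemigroup S) (f : ℕ → S) (m : ℕ) : Set S :=
  {x | ∃ F : Finset ℕ, F.Nonempty ∧ (∀ n ∈ F, m ≤ n) ∧ P.finProd f F = some x}

/-- An adequate sequence. -/
def AdequateSeq (P : PartialSemigroup S) (f : ℕ → S) : Prop :=
  (∀ F : Finset ℕ, F.Nonempty → (P.finProd f F).isSome) ∧
  (∀ K : Finset S, K.Nonempty → ∃ m : ℕ, P.FP f m ⊆ P.sigma K)

/-- `σ(W ∗ a)`, where `W ∗ a = {w ∗ a : w ∈ W}`. -/
def sigmaMulRight (P : PartialSemigroup S) (W : Finset S) (a : S) : Set S :=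
  {t | ∀ w ∈ W, ∀ y : S, P.op w a = some y → t ∈ P.phi y}

/-- `x⁻¹A = {t ∈ φ(x) : x ∗ t ∈ A}`. -/
def inv (P : PartialSemigroup S) (x : S) (A : Set S) : Set S :=
  {t | ∃ z : S, P.op x t = some z ∧ z ∈ A}

/-- A `J_δ`-set. -/
def JSet (P : PartialSemigroup S) (A : Set S) : Prop :=
  ∀ F : Finset {f : ℕ → S // P.AdequateSeq f}, F.Nonempty →
    ∀ W : Finset S, W.Nonempty →
      ∃ a ∈ P.sigma W, ∃ H : Finset ℕ, H.Nonempty ∧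
        ∀ f ∈ F, ∃ x : S, P.finProd f.1 H = some x ∧
          x ∈ P.sigmaMulRight W a ∧
          ∃ z : S, P.op a x = some z ∧ z ∈ A

/-- `δS`: the ultrafilters containing every `φ(s)`. -/
def delta (P : PartialSemigroup S) : Set (Ultrafilter S) :=
  {p | ∀ s : S, P.phi s ∈ p}

/-- `J_δ(S) = {p ∈ δS : every member of p is a J_δ-set}`. -/
def Jdelta (P : PartialSemigroup S) : Set (Ultrafilter S) :=
  {p | p ∈ P.delta ∧ ∀ A : Set S, A ∈ p → P.JSet A}

/-- `p` is idempotent: `A ∈ p ↔ {x : x⁻¹A ∈ p} ∈ p` for all `A`. -/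
def IsIdempotent (P : PartialSemigroup S) (p : Ultrafilter S) : Prop :=
  ∀ A : Set S, A ∈ p ↔ {x : S | P.inv x A ∈ p} ∈ p

/-- `B_f(T) = {x : f⌢x ∈ T}`, where functions with domain `{0,…,n−1}`
are modelled as lists of length `n` and `f⌢x` is `f ++ [x]`. -/
def Bf (T : Set (List S)) (f : List S) : Set S :=
  {x | f ++ [x] ∈ T}

/-- A `C`-set. -/
def CSet (P : PartialSemigroup S) (A : Set S) : Prop :=
  ∃ (α : Finset {f : ℕ → S // P.AdequateSeq f} → S)
    (H : Finset {f : ℕ → S // P.AdequateSeq f} → Finset ℕ),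
    (∀ F : Finset {f : ℕ → S // P.AdequateSeq f}, F.Nonempty → (H F).Nonempty) ∧
    (∀ F G : Finset {f : ℕ → S // P.AdequateSeq f}, F.Nonempty → F ⊂ G →
        ∀ i ∈ H F, ∀ j ∈ H G, i < j) ∧
    (∀ m : ℕ, ∀ G : Fin (m + 1) → Finset {f : ℕ → S // P.AdequateSeq f},
        (∀ i j : Fin (m + 1), i < j → G i ⊂ G j) → (G 0).Nonempty →
        ∀ f : Fin (m + 1) → {f : ℕ → S // P.AdequateSeq f}, (∀ i, f i ∈ G i) →
          ∃ z : S,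
            P.optListProd (List.ofFn (fun i =>
              (P.finProd (f i).1 (H (G i))).bind (fun x => P.op (α (G i)) x))) = some z ∧
            z ∈ A)

/-- A partial semigroup homomorphism. -/
def IsPSHom (P : PartialSemigroup S) (Q : PartialSemigroup T) (h : S → T) : Prop :=
  ∀ x y z : S, P.op x y = some z → Q.op (h x) (h y) = some (h z)

end PartialSemigroup

open PartialSemigroup

namespace PartialSemigroup

variable {S : Type u}

theorem listProd_cons (P : PartialSemigroup S) (x : S) {l : List S} (hl : l ≠ []) :
    P.listProd (x :: l) = (P.listProd l).bind (fun w => P.op x w) := by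
  cases l with
  | nil => exact absurd rfl hl
  | cons y l => rfl

theorem optListProd_cons (P : PartialSemigroup S) (x : Option S) {l : List (Option S)}
    (hl : l ≠ []) :
    P.optListProd (x :: l) =
      (P.optListProd l).bind (fun w => x.bind (fun a => P.op a w)) := by
  cases l with
  | nil => exact absurd rfl hl
  | cons y l => rfl

theorem listProd_append (P : PartialSemigroup S) {l₁ l₂ : List S} (h₁ : l₁ ≠ [])
    (h₂ : l₂ ≠ []) :
    P.listProd (l₁ ++ l₂) =
      (P.listProd l₂).bind (fun w => (P.listProd l₁).bind (fun a => P.op a w)) := by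
  induction l₁ with
  | nil => exact absurd rfl h₁
  | cons x l ih =>
    rw [List.cons_append, listProd_cons P x (List.append_ne_nil_of_right_ne_nil l h₂)]
    by_cases hl : l = []
    · subst hl
      rfl
    · rw [ih hl, listProd_cons P x hl]
      cases P.listProd l₂ with
      | none => rfl
      | some w =>
        cases P.listProd l with
        | none => rfl
        | some a => exact (P.assoc x a w).symm

/-- Generalized associativity: a product of products of nonempty blocks is the product of the
concatenation of the blocks. -/
theorem optListProd_map_listProd (P : PartialSemigroup S) {ι : Type*} (M : ι → List S)
    (hM : ∀ i, M i ≠ []) (l : List ι) :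
    P.optListProd (l.map (fun i => P.listProd (M i))) = P.listProd (l.flatMap M) := by
  induction l with
  | nil => rfl
  | cons i l ih =>
    by_cases hl : l = []
    · subst hl
      simp [optListProd]
    · have hflat : l.flatMap M ≠ [] := by
        obtain ⟨j, hj⟩ := List.exists_mem_of_ne_nil l hl
        intro h
        exact hM j (List.flatMap_eq_nil_iff.mp h j hj)
      rw [List.map_cons, optListProd_cons P _ (by simpa using hl), ih, List.flatMap_cons,
        listProd_append P (hM i) hflat]

theorem optListProd_map_some (P : PartialSemigroup S) {ι : Type*} (g : ι → S) (l : List ι) :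
    P.optListProd (l.map (fun i => some (g i))) = P.listProd (l.map g) := by
  have h := P.optListProd_map_listProd (fun i => [g i]) (fun i => List.cons_ne_nil _ _) l
  rw [List.map_eq_flatMap (f := g)]
  exact h

end PartialSemigroup

section Blocks

variable {H : ℕ → Finset ℕ}

theorem block_lt_of_lt (hHne : ∀ n, (H n).Nonempty)
    (hHsep : ∀ n, ∀ i ∈ H n, ∀ j ∈ H (n + 1), i < j) {m n : ℕ} (hmn : m < n) :
    ∀ i ∈ H m, ∀ j ∈ H n, i < j := by
  induction n, hmn using Nat.le_induction with
  | base => exact hHsep m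
  | succ n _ ih =>
    intro i hi j hj
    obtain ⟨k, hk⟩ := hHne n
    exact (ih i hi k hk).trans (hHsep n k hk j hj)

theorem le_of_mem_block (hHne : ∀ n, (H n).Nonempty)
    (hHsep : ∀ n, ∀ i ∈ H n, ∀ j ∈ H (n + 1), i < j) (n : ℕ) : ∀ i ∈ H n, n ≤ i := by
  induction n with
  | zero => exact fun i _ => Nat.zero_le i
  | succ n ih =>
    intro i hi
    obtain ⟨k, hk⟩ := hHne n
    exact (ih k hk).trans_lt (hHsep n k hk i hi)

theorem sort_biUnion_blocks (hHne : ∀ n, (H n).Nonempty)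
    (hHsep : ∀ n, ∀ i ∈ H n, ∀ j ∈ H (n + 1), i < j) (G : Finset ℕ) :
    (G.biUnion H).sort (· ≤ ·) =
      (G.sort (· ≤ ·)).flatMap (fun k => (H k).sort (· ≤ ·)) := by
  have hlt : ((G.sort (· ≤ ·)).flatMap (fun k => (H k).sort (· ≤ ·))).Pairwise (· < ·) := by
    refine List.pairwise_flatMap.mpr ⟨fun k _ => (H k).sortedLT_sort.pairwise, ?_⟩
    refine G.sortedLT_sort.pairwise.imp fun hmn i hi j hj => ?_
    exact block_lt_of_lt hHne hHsep hmn i (by simpa using hi) j (by simpa using hj)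
  refine List.Perm.eq_of_pairwise (le := (· < ·))
    (fun a b _ _ hab hba => absurd hab hba.asymm) (G.biUnion H).sortedLT_sort.pairwise hlt ?_
  rw [List.perm_ext_iff_of_nodup (Finset.sort_nodup _ _) (hlt.imp fun h => h.ne)]
  simp

end Blocks

namespace PartialSemigroup

variable {S : Type u}

theorem optListProd_finProd_blocks (P : PartialSemigroup S) (f : ℕ → S) {H : ℕ → Finset ℕ}
    (hHne : ∀ n, (H n).Nonempty) (hHsep : ∀ n, ∀ i ∈ H n, ∀ j ∈ H (n + 1), i < j)
    (G : Finset ℕ) :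
    P.optListProd ((G.sort (· ≤ ·)).map (fun k => P.finProd f (H k))) =
      P.finProd f (G.biUnion H) := by
  have hne : ∀ k, ((H k).sort (· ≤ ·)).map f ≠ [] := fun k h => by
    have hcard := congrArg List.length h
    simp only [List.length_map, Finset.length_sort, List.length_nil] at hcard
    exact (hHne k).card_pos.ne' hcard
  rw [finProd, sort_biUnion_blocks hHne hHsep, List.map_flatMap]
  exact P.optListProd_map_listProd _ hne _

/-- Block products of an adequate sequence form an adequate sequence. -/
theorem AdequateSeq.exists_blocks {P : PartialSemigroup S} {f : ℕ → S} (hf : P.AdequateSeq f)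
    {H : ℕ → Finset ℕ} (hHne : ∀ n, (H n).Nonempty)
    (hHsep : ∀ n, ∀ i ∈ H n, ∀ j ∈ H (n + 1), i < j) :
    ∃ g : ℕ → S, P.AdequateSeq g ∧ ∀ G : Finset ℕ, P.finProd g G =
      P.optListProd ((G.sort (· ≤ ·)).map (fun k => P.finProd f (H k))) := by
  choose g hg using fun k => Option.isSome_iff_exists.mp (hf.1 (H k) (hHne k))
  have hprod : ∀ G : Finset ℕ, P.finProd g G =
      P.optListProd ((G.sort (· ≤ ·)).map (fun k => P.finProd f (H k))) := fun G => by
    simp only [hg]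
    exact (P.optListProd_map_some g _).symm
  have hunion : ∀ G : Finset ℕ, P.finProd g G = P.finProd f (G.biUnion H) := fun G =>
    (hprod G).trans (P.optListProd_finProd_blocks f hHne hHsep G)
  refine ⟨g, ⟨fun G hG => ?_, fun K hK => ?_⟩, hprod⟩
  · rw [hunion]
    exact hf.1 _ (hG.biUnion fun k _ => hHne k)
  · obtain ⟨m, hm⟩ := hf.2 K hK
    refine ⟨m, ?_⟩
    rintro x ⟨G, hG, hGm, hx⟩
    refine hm ⟨G.biUnion H, hG.biUnion fun k _ => hHne k, fun i hi => ?_, hunion G ▸ hx⟩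
    obtain ⟨k, hk, hik⟩ := Finset.mem_biUnion.mp hi
    exact (hGm k hk).trans (le_of_mem_block hHne hHsep k i hik)

end PartialSemigroup

/-- If `A` is a `J_δ`-set, `F` is a finite nonempty set of adequate
sequences, and `⟨H n⟩` is a sequence of finite nonempty subsets of `ℕ` with
`max H n < min H (n+1)`, then for every finite nonempty `W ⊆ S` there exist
`a ∈ σ(W)` and `G ∈ 𝒫_f(ℕ)` such that for all `f ∈ F`,
`∏_{k ∈ G} ∏_{t ∈ H k} f t ∈ σ(W ∗ a)` and `a ∗ ∏_{k ∈ G} ∏_{t ∈ H k} f t ∈ A`. -/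
theorem stmt1 {S : Type u} (P : PartialSemigroup S) (hS : P.Adequate) (hc : P.Comm)
    (A : Set S) (hA : P.JSet A)
    (F : Finset {f : ℕ → S // P.AdequateSeq f}) (hF : F.Nonempty)
    (H : ℕ → Finset ℕ) (hHne : ∀ n : ℕ, (H n).Nonempty)
    (hHsep : ∀ n : ℕ, ∀ i ∈ H n, ∀ j ∈ H (n + 1), i < j)
    (W : Finset S) (hW : W.Nonempty) :
    ∃ a ∈ P.sigma W, ∃ G : Finset ℕ, G.Nonempty ∧
      ∀ f ∈ F, ∃ x : S,
        P.optListProd ((G.sort (· ≤ ·)).map (fun k => P.finProd f.1 (H k))) = some x ∧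
        x ∈ P.sigmaMulRight W a ∧
        ∃ z : S, P.op a x = some z ∧ z ∈ A := by
  classical
  choose g hg hgprod using fun f : {f : ℕ → S // P.AdequateSeq f} =>
    f.2.exists_blocks hHne hHsep
  obtain ⟨a, ha, G, hG, hGF⟩ :=
    hA (F.image fun f => ⟨g f, hg f⟩) (hF.image _) W hW
  refine ⟨a, ha, G, hG, fun f hf => ?_⟩
  obtain ⟨x, hx, hrest⟩ := hGF _ (Finset.mem_image_of_mem _ hf)
  exact ⟨x, (hgprod f G).symm.trans hx, hrest⟩
end

section
/- Let S be a commutative adequate partial semigroup, let p ∈ δS, let q ∈ J_δ(S), and let A ⊆ S. Then: (i) if {s ∈ S : s⁻¹A ∈ q} ∈ p, then A is a J_δ-set in S (i.e., p∗q ∈ J_δ(S)); and (ii) if {s ∈ S : s⁻¹A ∈ p} ∈ q, then A is a J_δ-set in S (i.e., q∗p ∈ J_δ(S)). Hence J_δ(S) is a two-sided ideal of δS. -/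
universe u v

open PartialSemigroup

namespace PartialSemigroup

variable {S : Type u} {P : PartialSemigroup S}

theorem op_assoc_right {x y z u v : S} (h : P.op x y = some u) (h' : P.op u z = some v) :
    ∃ w, P.op y z = some w ∧ P.op x w = some v := by
  have := P.assoc x y z
  rw [h, Option.bind_some, h'] at this
  exact Option.bind_eq_some_iff.1 this.symm

theorem op_assoc_left {x y z w v : S} (h : P.op y z = some w) (h' : P.op x w = some v) :
    ∃ u, P.op x y = some u ∧ P.op u z = some v := by
  have := P.assoc x y z
  rw [h, Option.bind_some, h'] at this
  exact Option.bind_eq_some_iff.1 this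

theorem mem_phi_iff {s t : S} : t ∈ P.phi s ↔ ∃ z, P.op s t = some z :=
  Option.isSome_iff_exists

theorem sigma_mem_of_mem_delta {p : Ultrafilter S} (hp : p ∈ P.delta) (W : Finset S) :
    ∀ᶠ t in (p : Filter S), t ∈ P.sigma W :=
  (Filter.eventually_all_finset W).2 fun s _ => hp s

theorem sigmaMulRight_mem_of_mem_delta {p : Ultrafilter S} (hp : p ∈ P.delta)
    (W : Finset S) (a : S) : ∀ᶠ t in (p : Filter S), t ∈ P.sigmaMulRight W a := by
  refine (Filter.eventually_all_finset W).2 fun w _ => ?_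
  rcases h : P.op w a with _ | y
  · simp
  · filter_upwards [hp y] with t ht y' hy'
    cases hy'
    exact ht

/-- `A` is a `J_δ`-set as soon as `s⁻¹A` is one for some `s` in each `σ(W)`. -/
theorem JSet.of_inv {A : Set S}
    (h : ∀ W : Finset S, W.Nonempty → ∃ s ∈ P.sigma W, P.JSet (P.inv s A)) : P.JSet A := by
  classical
  intro F hF W hW
  obtain ⟨s, hsW, hs⟩ := h W hW
  obtain ⟨a, ha, H, hH, hx⟩ := hs F hF
    (insert s (W.image fun w => (P.op w s).getD s)) (Finset.insert_nonempty _ _)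
  have mem_image : ∀ w ∈ W, ∀ y, P.op w s = some y →
      y ∈ insert s (W.image fun w => (P.op w s).getD s) := fun w hw y hy =>
    Finset.mem_insert_of_mem (Finset.mem_image.2 ⟨w, hw, by rw [hy, Option.getD_some]⟩)
  obtain ⟨b, hb⟩ := mem_phi_iff.1 (ha s (Finset.mem_insert_self _ _))
  refine ⟨b, fun w hw => ?_, H, hH, fun f hf => ?_⟩
  · obtain ⟨y, hy⟩ := mem_phi_iff.1 (hsW w hw)
    obtain ⟨v, hv⟩ := mem_phi_iff.1 (ha y (mem_image w hw y hy))
    obtain ⟨b', hb', hv'⟩ := op_assoc_right hy hv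
    obtain rfl : b = b' := Option.some.inj (hb.symm.trans hb')
    exact mem_phi_iff.2 ⟨v, hv'⟩
  · obtain ⟨x, hxH, hxσ, z, hz, c, hc, hcA⟩ := hx f hf
    refine ⟨x, hxH, fun w hw y hy => ?_, c, ?_, hcA⟩
    · obtain ⟨u, hu, huy⟩ := op_assoc_left hb hy
      exact hxσ u (mem_image w hw u hu) y huy
    · obtain ⟨b', hb', hc'⟩ := op_assoc_left hz hc
      obtain rfl : b = b' := Option.some.inj (hb.symm.trans hb')
      exact hc'

/-- In a commutative partial semigroup, `A` is a `J_δ`-set as soon as `{s : s⁻¹A ∈ p}` is one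
for some `p ∈ δS`. -/
theorem JSet.of_inv_mem (hc : P.Comm) {p : Ultrafilter S} (hp : p ∈ P.delta) {A : Set S}
    (h : P.JSet {s | P.inv s A ∈ p}) : P.JSet A := by
  intro F hF W hW
  obtain ⟨a, ha, H, hH, hx⟩ := h F hF W hW
  have : Nonempty S := ⟨a⟩
  choose! x hxH hxσ z hz hzA using hx
  have hA : ∀ᶠ t in (p : Filter S), ∀ f ∈ F, t ∈ P.inv (z f) A :=
    (Filter.eventually_all_finset F).2 hzA
  have hzσ : ∀ᶠ t in (p : Filter S), ∀ f ∈ F, t ∈ P.sigmaMulRight W (z f) :=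
    (Filter.eventually_all_finset F).2 fun f _ => sigmaMulRight_mem_of_mem_delta hp W (z f)
  have hφ : ∀ᶠ t in (p : Filter S), t ∈ P.phi a := hp a
  obtain ⟨t, htA, htz, hta, htW⟩ :=
    (hA.and (hzσ.and (hφ.and (sigmaMulRight_mem_of_mem_delta hp W a)))).exists
  obtain ⟨b, hb⟩ := mem_phi_iff.1 hta
  -- `(a ∗ x) ∗ t = (a ∗ t) ∗ x`, where definedness of the left side implies that of the right.
  have swap : ∀ f ∈ F, ∀ c, P.op (z f) t = some c → P.op b (x f) = some c := by
    intro f hf c hct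
    obtain ⟨v, hv, hav⟩ := op_assoc_right (hz f hf) hct
    rw [hc] at hv
    obtain ⟨b', hb', hbc⟩ := op_assoc_left hv hav
    obtain rfl : b = b' := Option.some.inj (hb.symm.trans hb')
    exact hbc
  refine ⟨b, fun w hw => ?_, H, hH, fun f hf => ?_⟩
  · obtain ⟨y, hy⟩ := mem_phi_iff.1 (ha w hw)
    obtain ⟨v, hv⟩ := mem_phi_iff.1 (htW w hw y hy)
    obtain ⟨b', hb', hv'⟩ := op_assoc_right hy hv
    obtain rfl : b = b' := Option.some.inj (hb.symm.trans hb')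
    exact mem_phi_iff.2 ⟨v, hv'⟩
  · obtain ⟨c, hct, hcA⟩ := htA f hf
    refine ⟨x f, hxH f hf, fun w hw y hy => ?_, c, swap f hf c hct, hcA⟩
    obtain ⟨u, hu⟩ := mem_phi_iff.1 (ha w hw)
    obtain ⟨v, hv⟩ := mem_phi_iff.1 (hxσ f hf w hw u hu)
    obtain ⟨z', hz', hwz⟩ := op_assoc_right hu hv
    obtain rfl : z f = z' := Option.some.inj ((hz f hf).symm.trans hz')
    obtain ⟨r, hr⟩ := mem_phi_iff.1 (htz f hf w hw v hwz)
    obtain ⟨c', hc', hwc⟩ := op_assoc_right hwz hr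
    obtain ⟨y', hy', hyr⟩ := op_assoc_left (swap f hf c' hc') hwc
    obtain rfl : y = y' := Option.some.inj (hy.symm.trans hy')
    exact mem_phi_iff.2 ⟨r, hyr⟩

end PartialSemigroup

/-- Let `p ∈ δS` and `q ∈ J_δ(S)`.  If `{s : s⁻¹A ∈ q} ∈ p` then `A`
is a `J_δ`-set (so `p∗q ∈ J_δ(S)`), and if `{s : s⁻¹A ∈ p} ∈ q` then `A` is a
`J_δ`-set (so `q∗p ∈ J_δ(S)`); hence `J_δ(S)` is a two-sided ideal of `δS`. -/
theorem stmt4 {S : Type u} (P : PartialSemigroup S) (hS : P.Adequate) (hc : P.Comm)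
    (p q : Ultrafilter S) (hp : p ∈ P.delta) (hq : q ∈ P.Jdelta) :
    (∀ A : Set S, {s : S | P.inv s A ∈ q} ∈ p → P.JSet A) ∧
    (∀ A : Set S, {s : S | P.inv s A ∈ p} ∈ q → P.JSet A) := by
  refine ⟨fun A hA => JSet.of_inv fun W _ => ?_, fun A hA => JSet.of_inv_mem hc hp (hq.2 _ hA)⟩
  have hA' : ∀ᶠ s in (p : Filter S), P.inv s A ∈ q := hA
  obtain ⟨s, hsW, hs⟩ := ((sigma_mem_of_mem_delta hp W).and hA').exists
  exact ⟨s, hsW, hq.2 _ hs⟩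
end

section
/- Let S be an adequate partial semigroup and let p ∈ δS. Then p is idempotent (i.e., for every A ⊆ S, A ∈ p if and only if {x ∈ S : x⁻¹A ∈ p} ∈ p) if and only if for each A ∈ p there is a nonempty set T of functions such that: (a) every f ∈ T has domain {0,…,n−1} for some n ≥ 0 and range contained in A; (b) for all f ∈ T, B_f(T) ∈ p; and (c) for all f ∈ T and all x ∈ B_f(T), B_{f⌢x}(T) ⊆ x⁻¹B_f(T). -/
universe u v

open PartialSemigroup

namespace PartialSemigroup

variable {S : Type u}

theorem inv_mono (P : PartialSemigroup S) (x : S) {A B : Set S} (h : A ⊆ B) :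
    P.inv x A ⊆ P.inv x B := by
  rintro t ⟨z, hz, hzA⟩
  exact ⟨z, hz, h hzA⟩

theorem inv_inter (P : PartialSemigroup S) (x : S) (A B : Set S) :
    P.inv x (A ∩ B) = P.inv x A ∩ P.inv x B := by
  ext t
  simp only [inv, Set.mem_ofPred_eq, Set.mem_inter_iff]
  constructor
  · rintro ⟨z, hz, hA, hB⟩
    exact ⟨⟨z, hz, hA⟩, ⟨z, hz, hB⟩⟩
  · rintro ⟨⟨z, hz, hA⟩, ⟨w, hw, hB⟩⟩
    obtain rfl : z = w := Option.some.inj (hz.symm.trans hw)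
    exact ⟨z, hz, hA, hB⟩

theorem inv_empty (P : PartialSemigroup S) (x : S) : P.inv x ∅ = ∅ := by
  ext t
  simp [inv]

/-- `(x ∗ y)⁻¹A = y⁻¹(x⁻¹A)` whenever `x ∗ y` is defined. -/
theorem inv_of_op_eq (P : PartialSemigroup S) {x y z : S} (h : P.op x y = some z) (A : Set S) :
    P.inv z A = P.inv y (P.inv x A) := by
  ext t
  have hassoc : P.op z t = (P.op y t).bind (fun w => P.op x w) := by
    simpa [h] using P.assoc x y t
  simp only [inv, Set.mem_ofPred_eq, hassoc, Option.bind_eq_some_iff]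
  grind

/-- `C` is `p`-invariant when `C ∈ p` and `x⁻¹C ∈ p` for each `x ∈ C`. -/
def IsInvariant (P : PartialSemigroup S) (p : Ultrafilter S) (C : Set S) : Prop :=
  C ∈ p ∧ ∀ x ∈ C, P.inv x C ∈ p

/-- For idempotent `p` and `A ∈ p`, the set `{x ∈ A : x⁻¹A ∈ p}` is `p`-invariant. -/
theorem IsIdempotent.isInvariant_star {P : PartialSemigroup S} {p : Ultrafilter S}
    (h : P.IsIdempotent p) {A : Set S} (hA : A ∈ p) :
    P.IsInvariant p (A ∩ {x | P.inv x A ∈ p}) := by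
  refine ⟨Filter.inter_mem hA ((h A).1 hA), ?_⟩
  rintro x ⟨-, hx⟩
  have hx' : P.inv x A ∈ p := hx
  filter_upwards [hx', (h _).1 hx'] with y hy hyp
  obtain ⟨z, hz, hzA⟩ := hy
  refine ⟨z, hz, hzA, ?_⟩
  change P.inv z A ∈ p
  rw [P.inv_of_op_eq hz]
  exact hyp

theorem IsInvariant.inter_inv {P : PartialSemigroup S} {p : Ultrafilter S} {C : Set S}
    (h : P.IsInvariant p C) {x : S} (hx : x ∈ C) : P.IsInvariant p (C ∩ P.inv x C) := by
  refine ⟨Filter.inter_mem h.1 (h.2 x hx), ?_⟩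
  rintro y ⟨hyC, z, hz, hzC⟩
  rw [inv_inter, ← P.inv_of_op_eq hz]
  exact Filter.inter_mem (h.2 y hyC) (h.2 z hzC)

/-- The set of admissible next entries after the list `f`, starting from `C`. -/
def next (P : PartialSemigroup S) (C : Set S) (f : List S) : Set S :=
  f.foldl (fun D x => D ∩ P.inv x D) C

/-- The lists each of whose entries is an admissible successor of the entries before it. -/
def tree (P : PartialSemigroup S) (C : Set S) : Set (List S) :=
  {f | ∀ g x, g ++ [x] <+: f → x ∈ P.next C g}

theorem next_append_singleton (P : PartialSemigroup S) (C : Set S) (f : List S) (x : S) :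
    P.next C (f ++ [x]) = P.next C f ∩ P.inv x (P.next C f) := by
  simp [next]

theorem next_subset (P : PartialSemigroup S) (C : Set S) (f : List S) : P.next C f ⊆ C := by
  induction f using List.reverseRecOn with
  | nil => exact subset_rfl
  | append_singleton f x ih =>
    rw [next_append_singleton]
    exact Set.inter_subset_left.trans ih

theorem append_singleton_mem_tree (P : PartialSemigroup S) {C : Set S} {f : List S} {x : S} :
    f ++ [x] ∈ P.tree C ↔ f ∈ P.tree C ∧ x ∈ P.next C f := by
  constructor
  · intro h
    exact ⟨fun g y hg => h g y (hg.trans (List.prefix_append f [x])), h f x List.prefix_rfl⟩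
  · rintro ⟨hf, hx⟩ g y hg
    rcases List.prefix_concat_iff.1 hg with h | h
    · obtain ⟨rfl, h⟩ := List.append_inj' h rfl
      obtain rfl : y = x := by simpa using h
      exact hx
    · exact hf g y h

theorem Bf_tree (P : PartialSemigroup S) {C : Set S} {f : List S} (hf : f ∈ P.tree C) :
    Bf (P.tree C) f = P.next C f := by
  ext x
  exact P.append_singleton_mem_tree.trans (and_iff_right hf)

theorem mem_of_mem_tree (P : PartialSemigroup S) {C : Set S} {f : List S} (hf : f ∈ P.tree C)
    {s : S} (hs : s ∈ f) : s ∈ C := by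
  obtain ⟨g, l, rfl⟩ := List.append_of_mem hs
  exact P.next_subset C g (hf g s ⟨l, by simp⟩)

theorem IsInvariant.next {P : PartialSemigroup S} {p : Ultrafilter S} {C : Set S}
    (h : P.IsInvariant p C) {f : List S} (hf : f ∈ P.tree C) :
    P.IsInvariant p (P.next C f) := by
  induction f using List.reverseRecOn with
  | nil => exact h
  | append_singleton f x ih =>
    obtain ⟨hf, hx⟩ := P.append_singleton_mem_tree.1 hf
    rw [next_append_singleton]
    exact (ih hf).inter_inv hx

/-- For idempotence it suffices that `{x : x⁻¹A ∈ p} ∈ p` for each `A ∈ p`. -/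
theorem isIdempotent_of_forall_mem {P : PartialSemigroup S} {p : Ultrafilter S}
    (h : ∀ A ∈ p, {x | P.inv x A ∈ p} ∈ p) : P.IsIdempotent p := by
  refine fun A => ⟨h A, fun hA => ?_⟩
  by_contra hn
  have hc := h _ (Ultrafilter.compl_mem_iff_notMem.2 hn)
  obtain ⟨x, hx, hxc⟩ := p.nonempty_of_mem (Filter.inter_mem hA hc)
  have hempty := Filter.inter_mem (show P.inv x A ∈ p from hx) (show P.inv x Aᶜ ∈ p from hxc)
  rw [← inv_inter, Set.inter_compl_self, inv_empty] at hempty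
  exact p.empty_notMem hempty

end PartialSemigroup

/-- `p ∈ δS` is idempotent iff for each `A ∈ p` there is a nonempty
set `T` of functions (with initial-segment domains, modelled as lists) such that:
(a) each `f ∈ T` has range contained in `A`; (b) `B_f(T) ∈ p` for all `f ∈ T`;
(c) `B_{f⌢x}(T) ⊆ x⁻¹B_f(T)` for all `f ∈ T` and `x ∈ B_f(T)`. -/
theorem stmt5 {S : Type u} (P : PartialSemigroup S) (hS : P.Adequate)
    (p : Ultrafilter S) (hp : p ∈ P.delta) :
    P.IsIdempotent p ↔
      ∀ A : Set S, A ∈ p →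
        ∃ T : Set (List S), T.Nonempty ∧
          (∀ f ∈ T, ∀ s ∈ f, s ∈ A) ∧
          (∀ f ∈ T, Bf T f ∈ p) ∧
          (∀ f ∈ T, ∀ x ∈ Bf T f, Bf T (f ++ [x]) ⊆ P.inv x (Bf T f)) := by
  constructor
  · intro h A hA
    have hC := h.isInvariant_star hA
    refine ⟨P.tree (A ∩ {x | P.inv x A ∈ p}), ⟨[], fun g x hg => by simp at hg⟩,
      fun f hf s hs => (P.mem_of_mem_tree hf hs).1, fun f hf => ?_, fun f hf x hx => ?_⟩
    · rw [P.Bf_tree hf]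
      exact (hC.next hf).1
    · rw [P.Bf_tree hx, P.Bf_tree hf, next_append_singleton]
      exact Set.inter_subset_right
  · refine fun h => isIdempotent_of_forall_mem fun A hA => ?_
    obtain ⟨T, ⟨f, hf⟩, hTA, hTp, hT⟩ := h A hA
    filter_upwards [hTp f hf] with x hx
    have hsub : Bf T f ⊆ A := fun y hy => hTA _ hy y (by simp)
    exact Filter.mem_of_superset (hTp _ hx) ((hT f hf x hx).trans (P.inv_mono x hsub))
end

section
/- Let S be a commutative adequate partial semigroup and let A ⊆ S. Suppose there is an idempotent ultrafilter p ∈ J_δ(S) with A ∈ p. Then there is a nonempty set T of functions such that: (i) every f ∈ T has domain {0,…,n−1} for some n ≥ 0 and range contained in A; (ii) for all f ∈ T and all x ∈ B_f(T), B_{f⌢x}(T) ⊆ x⁻¹B_f(T); and (iii) for every finite nonempty F ⊆ T, ⋂_{f∈F} B_f(T) is a J_δ-set. Moreover, there is a downward directed family ⟨A_F⟩_{F∈I} of subsets of A such that: (a) for all F ∈ I and all x ∈ A_F there exists G ∈ I with A_G ⊆ x⁻¹A_F; and (b) for each finite nonempty ℱ ⊆ I, ⋂_{F∈ℱ} A_F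 is a J_δ-set. -/
universe u v

namespace PartialSemigroup

variable {S : Type u}

/-- `D ∈ p`, and `x⁻¹D ∈ p` for every `x ∈ D`. -/
def StarClosed (P : PartialSemigroup S) (p : Ultrafilter S) (D : Set S) : Prop :=
  D ∈ p ∧ ∀ x ∈ D, P.inv x D ∈ p

theorem inv_inv_eq (P : PartialSemigroup S) {x t z : S} (hz : P.op x t = some z)
    (A : Set S) : P.inv t (P.inv x A) = P.inv z A := by
  ext u
  have h := P.assoc x t u
  rw [hz, Option.bind_some] at h
  constructor
  · rintro ⟨v, hv, w, hw, hwA⟩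
    rw [hv, Option.bind_some] at h
    exact ⟨w, h.trans hw, hwA⟩
  · rintro ⟨w, hw, hwA⟩
    rw [hw] at h
    obtain ⟨v, hv, hvw⟩ := Option.bind_eq_some_iff.mp h.symm
    exact ⟨v, hv, w, hvw, hwA⟩

/-- For idempotent `p`, the set `{x ∈ A : x⁻¹A ∈ p}` is star-closed. -/
theorem IsIdempotent.starClosed {P : PartialSemigroup S} {p : Ultrafilter S}
    (hid : P.IsIdempotent p) {A : Set S} (hA : A ∈ p) :
    P.StarClosed p {x | x ∈ A ∧ P.inv x A ∈ p} := by
  refine ⟨Filter.inter_mem hA ((hid A).mp hA), fun x hx => ?_⟩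
  filter_upwards [hx.2, (hid _).mp hx.2] with t ht htA
  obtain ⟨z, hz, hzA⟩ := ht
  exact ⟨z, hz, hzA, by rwa [P.inv_inv_eq hz] at htA⟩

theorem StarClosed.inter {P : PartialSemigroup S} {p : Ultrafilter S} {D E : Set S}
    (hD : P.StarClosed p D) (hE : P.StarClosed p E) : P.StarClosed p (D ∩ E) := by
  refine ⟨Filter.inter_mem hD.1 hE.1, fun x hx => ?_⟩
  filter_upwards [hD.2 x hx.1, hE.2 x hx.2] with t ht htE
  obtain ⟨z, hz, hzD⟩ := ht
  obtain ⟨w, hw, hwE⟩ := htE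
  obtain rfl : z = w := Option.some.inj (hz.symm.trans hw)
  exact ⟨z, hz, hzD, hwE⟩

theorem StarClosed.inv {P : PartialSemigroup S} {p : Ultrafilter S} {D : Set S}
    (hD : P.StarClosed p D) {x : S} (hx : x ∈ D) : P.StarClosed p (P.inv x D) := by
  refine ⟨hD.2 x hx, ?_⟩
  rintro y ⟨z, hz, hzD⟩
  rw [P.inv_inv_eq hz]
  exact hD.2 z hzD

/-- The set of admissible continuations of a branch that started with admissible set `D`. -/
def continuations (P : PartialSemigroup S) (D : Set S) (f : List S) : Set S :=
  f.foldl (fun E x => E ∩ P.inv x E) D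

/-- Every entry of the list is an admissible continuation of the entries before it. -/
def IsBranch (P : PartialSemigroup S) : Set S → List S → Prop
  | _, [] => True
  | D, x :: l => x ∈ D ∧ P.IsBranch (D ∩ P.inv x D) l

theorem isBranch_append_singleton (P : PartialSemigroup S) (D : Set S) (f : List S) (x : S) :
    P.IsBranch D (f ++ [x]) ↔ P.IsBranch D f ∧ x ∈ P.continuations D f := by
  induction f generalizing D with
  | nil => simp [IsBranch, continuations]
  | cons y l ih => simp [IsBranch, ih, continuations, and_assoc]

theorem IsBranch.subset {P : PartialSemigroup S} {D : Set S} {f : List S}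
    (hf : P.IsBranch D f) : ∀ s ∈ f, s ∈ D := by
  induction f generalizing D with
  | nil => simp
  | cons y l ih =>
    intro s hs
    rcases List.mem_cons.mp hs with rfl | hs
    · exact hf.1
    · exact (ih hf.2 s hs).1

theorem StarClosed.continuations {P : PartialSemigroup S} {p : Ultrafilter S} {D : Set S}
    (hD : P.StarClosed p D) {f : List S} (hf : P.IsBranch D f) :
    P.StarClosed p (P.continuations D f) := by
  induction f generalizing D with
  | nil => exact hD
  | cons y l ih => exact ih (hD.inter (hD.inv hf.1)) hf.2

theorem Bf_isBranch {P : PartialSemigroup S} {D : Set S} {f : List S}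
    (hf : P.IsBranch D f) : Bf {g | P.IsBranch D g} f = P.continuations D f := by
  ext x
  exact (P.isBranch_append_singleton D f x).trans (and_iff_right hf)

end PartialSemigroup

open PartialSemigroup

/-- Let `A ∈ p` for an idempotent `p ∈ J_δ(S)`.  Then there is a
nonempty set `T` of functions satisfying (i)–(iii), and moreover a downward
directed family of subsets of `A` satisfying (a) and (b). -/
theorem stmt6 {S : Type u} (P : PartialSemigroup S) (hS : P.Adequate) (hc : P.Comm)
    (A : Set S) (p : Ultrafilter S) (hp : p ∈ P.Jdelta) (hid : P.IsIdempotent p)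
    (hA : A ∈ p) :
    (∃ T : Set (List S), T.Nonempty ∧
      (∀ f ∈ T, ∀ s ∈ f, s ∈ A) ∧
      (∀ f ∈ T, ∀ x ∈ Bf T f, Bf T (f ++ [x]) ⊆ P.inv x (Bf T f)) ∧
      (∀ F : Finset (List S), F.Nonempty → (↑F : Set (List S)) ⊆ T →
        P.JSet (⋂ f ∈ F, Bf T f))) ∧
    (∃ 𝓘 : Set (Set S), 𝓘.Nonempty ∧
      (∀ B ∈ 𝓘, B ⊆ A) ∧
      (∀ B ∈ 𝓘, ∀ C ∈ 𝓘, ∃ D ∈ 𝓘, D ⊆ B ∧ D ⊆ C) ∧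
      (∀ B ∈ 𝓘, ∀ x ∈ B, ∃ C ∈ 𝓘, C ⊆ P.inv x B) ∧
      (∀ 𝓕 : Finset (Set S), 𝓕.Nonempty → (↑𝓕 : Set (Set S)) ⊆ 𝓘 →
        P.JSet (⋂ B ∈ 𝓕, B))) := by
  have hstar := hid.starClosed hA
  set D : Set S := {x | x ∈ A ∧ P.inv x A ∈ p}
  refine ⟨⟨{f | P.IsBranch D f}, ⟨[], trivial⟩, fun f hf s hs => (hf.subset s hs).1, ?_, ?_⟩,
    ⟨{B | P.StarClosed p B ∧ B ⊆ A}, ⟨D, hstar, fun x hx => hx.1⟩, fun B hB => hB.2, ?_, ?_, ?_⟩⟩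
  · intro f hf x hx
    rw [Bf_isBranch hf, Bf_isBranch hx, continuations, List.foldl_append]
    exact Set.inter_subset_right
  · intro F _ hF
    refine hp.2 _ ((Filter.biInter_finset_mem F).mpr fun f hf => ?_)
    rw [Bf_isBranch (hF hf)]
    exact (hstar.continuations (hF hf)).1
  · intro B hB C hC
    exact ⟨B ∩ C, ⟨hB.1.inter hC.1, fun x hx => hB.2 hx.1⟩,
      Set.inter_subset_left, Set.inter_subset_right⟩
  · intro B hB x hx
    exact ⟨B ∩ P.inv x B, ⟨hB.1.inter (hB.1.inv hx), fun y hy => hB.2 hy.1⟩,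
      Set.inter_subset_right⟩
  · intro 𝓕 _ h𝓕
    exact hp.2 _ ((Filter.biInter_finset_mem 𝓕).mpr fun B hB => (h𝓕 hB).1.1)
end

section
/- Let S be a countable commutative adequate partial semigroup and let A ⊆ S. Suppose there is an idempotent ultrafilter p ∈ J_δ(S) with A ∈ p. Then there is a decreasing sequence ⟨A_n⟩_{n=1}^∞ of subsets of A such that: (i) for all n ∈ ℕ and all x ∈ A_n there exists m ∈ ℕ such that A_m ⊆ x⁻¹A_n; and (ii) for all n ∈ ℕ, A_n is a J_δ-set. -/
universe u v

open PartialSemigroup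

namespace PartialSemigroup

/-- Left translates compose: `t ∈ y⁻¹(x⁻¹A)` iff `t ∈ (x ∗ y)⁻¹A` when `x ∗ y` is defined. -/
theorem mem_inv_inv_iff {S : Type u} (P : PartialSemigroup S) {x y z : S}
    (h : P.op x y = some z) (A : Set S) (t : S) :
    t ∈ P.inv y (P.inv x A) ↔ t ∈ P.inv z A := by
  have ha := P.assoc x y t
  rw [h, Option.bind_some] at ha
  constructor
  · rintro ⟨w, hw, v, hv, hvA⟩
    rw [hw, Option.bind_some] at ha
    exact ⟨v, ha.trans hv, hvA⟩
  · rintro ⟨v, hv, hvA⟩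
    rw [hv] at ha
    obtain ⟨w, hw, hxw⟩ := Option.bind_eq_some_iff.mp ha.symm
    exact ⟨w, hw, v, hxw, hvA⟩

/-- `A⋆ = {x ∈ A : x⁻¹A ∈ p}`. -/
def star {S : Type u} (P : PartialSemigroup S) (p : Ultrafilter S) (A : Set S) : Set S :=
  {x | x ∈ A ∧ P.inv x A ∈ p}

theorem IsIdempotent.star_mem {S : Type u} {P : PartialSemigroup S} {p : Ultrafilter S}
    (hid : P.IsIdempotent p) {A : Set S} (hA : A ∈ p) : P.star p A ∈ p :=
  Filter.inter_mem hA ((hid A).mp hA)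

theorem IsIdempotent.inv_star_mem {S : Type u} {P : PartialSemigroup S} {p : Ultrafilter S}
    (hid : P.IsIdempotent p) {A : Set S} {x : S} (hx : x ∈ P.star p A) :
    P.inv x (P.star p A) ∈ p := by
  filter_upwards [hid.star_mem hx.2] with t ht
  obtain ⟨⟨z, hz, hzA⟩, ht'⟩ := ht
  refine ⟨z, hz, hzA, ?_⟩
  filter_upwards [ht'] with s hs
  exact (P.mem_inv_inv_iff hz A s).mp hs

/-- The points of `B` lying in `(s k)⁻¹B` for each `k < n` with `s k ∈ B`. -/
def translateInter {S : Type u} (P : PartialSemigroup S) (s : ℕ → S) (B : Set S) (n : ℕ) :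
    Set S :=
  {y | y ∈ B ∧ ∀ k < n, s k ∈ B → y ∈ P.inv (s k) B}

theorem exists_translateInter_subset_inv {S : Type u} (P : PartialSemigroup S) {s : ℕ → S}
    (hs : Function.Surjective s) (B : Set S) (n : ℕ) {x : S}
    (hx : x ∈ P.translateInter s B n) :
    ∃ m, P.translateInter s B m ⊆ P.inv x (P.translateInter s B n) := by
  choose g hg using hs
  let e : ℕ → ℕ := fun k => (P.op (s k) x).elim 0 g
  refine ⟨max (g x) ((Finset.range n).sup e) + 1, fun y hy => ?_⟩
  have hB : ∀ z ∈ B, g z ≤ max (g x) ((Finset.range n).sup e) → y ∈ P.inv z B := by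
    intro z hz hle
    have := hy.2 (g z) (Nat.lt_succ_of_le hle)
    rw [hg] at this
    exact this hz
  obtain ⟨v, hv, hvB⟩ := hB x hx.1 (le_max_left _ _)
  refine ⟨v, hv, hvB, fun k hk hkB => ?_⟩
  obtain ⟨z, hz, hzB⟩ := hx.2 k hk hkB
  have he : g z ≤ (Finset.range n).sup e := by
    have := Finset.le_sup (f := e) (Finset.mem_range.mpr hk)
    simpa only [e, hz, Option.elim_some] using this
  obtain ⟨w, hw, hwB⟩ :=
    (P.mem_inv_inv_iff hz B y).mpr (hB z hzB (he.trans (le_max_right _ _)))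
  rw [hv] at hw
  cases hw
  exact hwB

end PartialSemigroup

/-- If `S` is a countable commutative adequate partial semigroup
and `A ∈ p` for some idempotent `p ∈ J_δ(S)`, then there is a decreasing sequence
`⟨A n⟩` of subsets of `A` such that (i) for all `n` and `x ∈ A n` there is `m` with
`A m ⊆ x⁻¹(A n)`, and (ii) each `A n` is a `J_δ`-set. -/
theorem stmt7 {S : Type u} [Countable S] (P : PartialSemigroup S)
    (hS : P.Adequate) (hc : P.Comm)
    (A : Set S) (p : Ultrafilter S) (hp : p ∈ P.Jdelta) (hid : P.IsIdempotent p)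
    (hA : A ∈ p) :
    ∃ As : ℕ → Set S,
      (∀ n : ℕ, As (n + 1) ⊆ As n) ∧
      (∀ n : ℕ, As n ⊆ A) ∧
      (∀ n : ℕ, ∀ x ∈ As n, ∃ m : ℕ, As m ⊆ P.inv x (As n)) ∧
      (∀ n : ℕ, P.JSet (As n)) := by
  have : Nonempty S := p.nonempty_of_mem hA |>.to_type
  obtain ⟨s, hs⟩ := exists_surjective_nat S
  refine ⟨P.translateInter s (P.star p A), fun n y hy => ⟨hy.1, fun k hk => hy.2 k (by omega)⟩,
    fun n y hy => hy.1.1,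
    fun n x hx => P.exists_translateInter_subset_inv hs _ n hx,
    fun n => hp.2 _ (Filter.inter_mem (hid.star_mem hA) ?_)⟩
  refine Filter.mem_of_superset ((Filter.biInter_mem (Set.finite_lt_nat n)).mpr fun k _ => ?_)
    fun y hy k hk => Set.mem_iInter₂.mp hy k hk
  by_cases hk : s k ∈ P.star p A
  · exact Filter.mem_of_superset (hid.inv_star_mem hk) (fun y hy _ => hy)
  · exact Filter.univ_mem' (fun y h => absurd h hk)
end

section
/- Let S and T be adequate partial semigroups and let h : S → T be a surjective partial semigroup homomorphism. Then for every p ∈ δS, the pushforward h̃(p) belongs to δT; moreover, for all p, q ∈ δS and all A ⊆ T, one has {t ∈ T : t⁻¹A ∈ h̃(q)} ∈ h̃(p) if and only if {s ∈ S : s⁻¹(h⁻¹(A)) ∈ q} ∈ p (i.e., h̃(p∗q) = h̃(p)∗h̃(q), so h̃ restricted to δS is a semigroup homomorphism). -/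
universe u v

open PartialSemigroup

namespace PartialSemigroup

variable {S : Type u} {T : Type v} {P : PartialSemigroup S} {Q : PartialSemigroup T} {h : S → T}

theorem IsPSHom.phi_subset_preimage (hhom : IsPSHom P Q h) (s : S) :
    P.phi s ⊆ h ⁻¹' Q.phi (h s) := by
  intro t ht
  obtain ⟨z, hz⟩ := Option.isSome_iff_exists.mp ht
  exact Option.isSome_iff_exists.mpr ⟨h z, hhom s t z hz⟩

theorem IsPSHom.mem_inv_iff (hhom : IsPSHom P Q h) {s t : S} (ht : t ∈ P.phi s) (A : Set T) :
    h t ∈ Q.inv (h s) A ↔ t ∈ P.inv s (h ⁻¹' A) := by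
  obtain ⟨z, hz⟩ := Option.isSome_iff_exists.mp ht
  simp [inv, hz, hhom s t z hz]

theorem IsPSHom.inv_mem_map_iff (hhom : IsPSHom P Q h) {q : Ultrafilter S} (hq : q ∈ P.delta)
    (s : S) (A : Set T) :
    Q.inv (h s) A ∈ Ultrafilter.map h q ↔ P.inv s (h ⁻¹' A) ∈ q := by
  rw [Ultrafilter.mem_map]
  refine Filter.congr_sets (f := (q : Filter S)) ?_
  filter_upwards [hq s] with t ht using hhom.mem_inv_iff ht A

end PartialSemigroup

/-- If `h : S → T` is a surjective partial semigroup homomorphism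
between adequate partial semigroups, then the pushforward `h̃` maps `δS` into `δT`,
and for `p, q ∈ δS` and `A ⊆ T` one has
`{t : t⁻¹A ∈ h̃(q)} ∈ h̃(p) ↔ {s : s⁻¹(h⁻¹(A)) ∈ q} ∈ p`
(i.e. `h̃(p∗q) = h̃(p)∗h̃(q)`, so `h̃` restricted to `δS` is a homomorphism). -/
theorem stmt11 {S : Type u} {T : Type v}
    (P : PartialSemigroup S) (Q : PartialSemigroup T)
    (hS : P.Adequate) (hT : Q.Adequate)
    (h : S → T) (hhom : IsPSHom P Q h) (hsurj : Function.Surjective h) :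
    (∀ p ∈ P.delta, Ultrafilter.map h p ∈ Q.delta) ∧
    (∀ p q : Ultrafilter S, p ∈ P.delta → q ∈ P.delta →
      ∀ A : Set T,
        ({t : T | Q.inv t A ∈ Ultrafilter.map h q} ∈ Ultrafilter.map h p ↔
          {s : S | P.inv s (h ⁻¹' A) ∈ q} ∈ p)) := by
  refine ⟨fun p hp t => ?_, fun p q _ hq A => ?_⟩
  · obtain ⟨s, rfl⟩ := hsurj t
    exact Ultrafilter.mem_map.mpr (Filter.mem_of_superset (hp s) (hhom.phi_subset_preimage s))
  · simp only [Ultrafilter.mem_map, Set.preimage_ofPred_eq, ← hhom.inv_mem_map_iff hq]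
end
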